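/- arXiv:1605.05121 — 2 statements merged into one kernel-verified Lean document; each statement's English description precedes it below -/
import Mathlib

section
/- Let σ(n) be the minimum m such that every set of m unit vectors in R^n is selectively balancing. Then σ(n)/(n log₂ n) → 1/2 as n → ∞. -/
def SelectivelyBalancing {n m : ℕ} (u : Fin m → EuclideanSpace ℝ (Fin n)) : Prop :=
  ∃ ε : Fin m → ℝ, (∀ i, ε i = -1 ∨ ε i = 0 ∨ ε i = 1) ∧ ε ≠ 0 ∧
    ‖∑ i, ε i • u i‖ < 1

/-- `σ(n)`: the least `m` such that every `m` unit vectors in `ℝ^n` are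
selectively balancing. -/
noncomputable def sigma' (n : ℕ) : ℕ :=
  sInf {m : ℕ | ∀ u : Fin m → EuclideanSpace ℝ (Fin n),
    (∀ i, ‖u i‖ = 1) → SelectivelyBalancing u}

open Filter Topology Finset

open MeasureTheory Metric Module in
/-- Volume bound for the number of `1`-separated points in a ball of radius `R`. -/
theorem card_le_of_one_separated {E : Type*} [NormedAddCommGroup E] [NormedSpace ℝ E]
    [FiniteDimensional ℝ E] {R : ℝ} (hR : 0 ≤ R) (s : Finset E) (hs : ∀ c ∈ s, ‖c‖ ≤ R)
    (h : ∀ c ∈ s, ∀ d ∈ s, c ≠ d → 1 ≤ ‖c - d‖) :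
    (s.card : ℝ) ≤ (2 * R + 1) ^ finrank ℝ E := by
  borelize E
  let μ : Measure E := Measure.addHaar
  have half_pos : (0 : ℝ) < 1 / 2 := by norm_num
  have radius_pos : 0 < R + 1 / 2 := by positivity
  have disjoint_balls :
      Set.Pairwise (s : Set E) (Function.onFun Disjoint fun c => ball (c : E) (1 / 2)) := by
    rintro c hc d hd hcd
    apply ball_disjoint_ball
    rw [dist_eq_norm]
    have := h c hc d hd hcd
    linarith
  have subset_ball : (⋃ c ∈ s, ball (c : E) (1 / 2)) ⊆ ball (0 : E) (R + 1 / 2) := by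
    refine Set.iUnion₂_subset fun x hx => ball_subset_ball' ?_
    rw [dist_zero_right]
    linarith [hs x hx]
  have volume_le := measure_mono (μ := μ) subset_ball
  rw [measure_biUnion_finset disjoint_balls fun c _ => measurableSet_ball] at volume_le
  simp only [μ.addHaar_ball_of_pos _ half_pos, μ.addHaar_ball_of_pos _ radius_pos,
    Finset.sum_const, nsmul_eq_mul, ← mul_assoc] at volume_le
  have key := (ENNReal.mul_le_mul_iff_left (measure_ball_pos _ _ zero_lt_one).ne'
    measure_ball_lt_top.ne).1 volume_le
  have := ENNReal.toReal_le_of_le_ofReal (pow_nonneg radius_pos.le _) key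
  rw [ENNReal.toReal_mul, ENNReal.toReal_ofReal (by positivity), ENNReal.toReal_natCast] at this
  calc (s.card : ℝ) = s.card * (1 / 2) ^ finrank ℝ E * 2 ^ finrank ℝ E := by
        rw [mul_assoc, ← mul_pow]; norm_num
    _ ≤ (R + 1 / 2) ^ finrank ℝ E * 2 ^ finrank ℝ E := by gcongr
    _ = (2 * R + 1) ^ finrank ℝ E := by rw [← mul_pow]; ring

/-- Summed over all choices of signs, `‖∑ ± u i‖ ^ 2` averages to `∑ ‖u i‖ ^ 2`. -/
theorem sum_powerset_norm_sq {E ι : Type*} [NormedAddCommGroup E] [InnerProductSpace ℝ E]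
    [DecidableEq ι] (u : ι → E) (s : Finset ι) :
    ∑ A ∈ s.powerset, ‖∑ i ∈ s, (if i ∈ A then (1 : ℝ) else -1) • u i‖ ^ 2 =
      2 ^ s.card * ∑ i ∈ s, ‖u i‖ ^ 2 := by
  induction s using Finset.induction_on with
  | empty => simp
  | insert a s ha ih =>
    rw [sum_powerset_insert ha, ← sum_add_distrib, card_insert_of_notMem ha, sum_insert ha]
    have step : ∀ A ∈ s.powerset,
        ‖∑ i ∈ insert a s, (if i ∈ A then (1 : ℝ) else -1) • u i‖ ^ 2 +
          ‖∑ i ∈ insert a s, (if i ∈ insert a A then (1 : ℝ) else -1) • u i‖ ^ 2 =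
        2 * ‖u a‖ ^ 2 + 2 * ‖∑ i ∈ s, (if i ∈ A then (1 : ℝ) else -1) • u i‖ ^ 2 := by
      intro A hA
      have haA : a ∉ A := fun h => ha (mem_powerset.1 hA h)
      have same : ∑ i ∈ s, (if i ∈ insert a A then (1 : ℝ) else -1) • u i =
          ∑ i ∈ s, (if i ∈ A then (1 : ℝ) else -1) • u i := by
        refine sum_congr rfl fun i hi => ?_
        have : i ≠ a := fun h => ha (h ▸ hi)
        simp [this]
      rw [sum_insert ha, sum_insert ha, same]
      simp only [haA, mem_insert_self, if_true, if_false, one_smul, neg_one_smul]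
      rw [neg_add_eq_sub, norm_sub_rev]
      have := parallelogram_law_with_norm ℝ (u a) (∑ i ∈ s, (if i ∈ A then (1 : ℝ) else -1) • u i)
      linarith
    rw [sum_congr rfl step, sum_add_distrib, sum_const, ← mul_sum, ih, card_powerset,
      nsmul_eq_mul]
    push_cast
    ring

theorem selectivelyBalancing_of_lt {n m : ℕ} (h : 2 * (√(2 * m) + 1) ^ n < (2 : ℝ) ^ m)
    (u : Fin m → EuclideanSpace ℝ (Fin n)) (hu : ∀ i, ‖u i‖ = 1) : SelectivelyBalancing u := by
  classical
  by_contra hnot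
  rcases Nat.eq_zero_or_pos m with rfl | hm
  · norm_num at h
  let x : Finset (Fin m) → EuclideanSpace ℝ (Fin n) := fun A =>
    ∑ i, (if i ∈ A then (1 : ℝ) else -1) • u i
  have separated (A B : Finset (Fin m)) (hAB : A ≠ B) : 2 ≤ ‖x A - x B‖ := by
    by_contra! hlt
    apply hnot
    refine ⟨fun i => ((if i ∈ A then (1 : ℝ) else -1) - if i ∈ B then (1 : ℝ) else -1) / 2,
      fun i => ?_, fun h0 => hAB ?_, ?_⟩
    · by_cases h1 : i ∈ A <;> by_cases h2 : i ∈ B <;> norm_num [h1, h2]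
    · ext i
      have := congrFun h0 i
      by_cases h1 : i ∈ A <;> by_cases h2 : i ∈ B <;>
        first
        | simp only [h1, h2]; done
        | norm_num [h1, h2] at this
    · have : ∑ i, (((if i ∈ A then (1 : ℝ) else -1) - if i ∈ B then (1 : ℝ) else -1) / 2) • u i
          = (1 / 2 : ℝ) • (x A - x B) := by
        simp only [x, smul_sum, ← sum_sub_distrib, ← sub_smul, smul_smul]
        refine sum_congr rfl fun i _ => ?_
        congr 1
        ring
      rw [this, norm_smul]
      norm_num
      linarith
  have total : ∑ A, ‖x A‖ ^ 2 = 2 ^ m * m := by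
    have := sum_powerset_norm_sq u univ
    simp only [powerset_univ, card_univ, Fintype.card_fin, hu, one_pow, sum_const, nsmul_eq_mul,
      mul_one] at this
    exact this
  let good := univ.filter fun A : Finset (Fin m) => ‖x A‖ ^ 2 ≤ 2 * m
  have good_card : (2 : ℝ) ^ m ≤ 2 * good.card := by
    have markov : ∑ A, (if ‖x A‖ ^ 2 ≤ 2 * m then 0 else (2 * m : ℝ)) ≤ ∑ A, ‖x A‖ ^ 2 := by
      refine sum_le_sum fun A _ => ?_
      split_ifs with hA
      · positivity
      · exact (not_le.1 hA).le
    have count := card_filter_add_card_filter_not (s := (univ : Finset (Finset (Fin m))))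
      (fun A => ‖x A‖ ^ 2 ≤ 2 * m)
    rw [total, sum_ite, sum_const_zero, zero_add, sum_const, nsmul_eq_mul] at markov
    rw [card_univ, Fintype.card_finset, Fintype.card_fin] at count
    have count' : (good.card : ℝ) + (univ.filter fun A => ¬ ‖x A‖ ^ 2 ≤ 2 * m).card = 2 ^ m := by
      rw [← Nat.cast_add, count, Nat.cast_pow, Nat.cast_two]
    have hm' : (0 : ℝ) < m := by exact_mod_cast hm
    have : 2 * ((univ.filter fun A => ¬ ‖x A‖ ^ 2 ≤ 2 * m).card : ℝ) ≤ 2 ^ m := by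
      refine le_of_mul_le_mul_right ?_ hm'
      linarith
    linarith
  have inj : Function.Injective fun A => (1 / 2 : ℝ) • x A := by
    intro A B hAB
    by_contra hne
    have h1 := separated A B hne
    have h2 : x A = x B := smul_right_injective _ (by norm_num : (1 / 2 : ℝ) ≠ 0) hAB
    rw [h2, sub_self, norm_zero] at h1
    norm_num at h1
  have bound := card_le_of_one_separated (R := √(2 * m) / 2) (by positivity)
    (good.image fun A => (1 / 2 : ℝ) • x A) (by
      simp only [mem_image, forall_exists_index, and_imp]
      rintro _ A hA rfl
      have : ‖x A‖ ≤ √(2 * m) := Real.le_sqrt_of_sq_le (mem_filter.1 hA).2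
      rw [norm_smul, Real.norm_of_nonneg (by norm_num)]
      linarith) (by
      simp only [mem_image, forall_exists_index, and_imp]
      rintro _ A hA rfl _ B hB rfl hne
      have := separated A B fun h => hne (by rw [h])
      rw [← smul_sub, norm_smul, Real.norm_of_nonneg (by norm_num)]
      linarith)
  rw [card_image_of_injective _ inj, finrank_euclideanSpace_fin, mul_div_cancel₀ _ two_ne_zero]
    at bound
  linarith

/-- Few sign vectors `q` make `‖z + q‖` smaller than the norm `√r` of a sign vector. -/
theorem card_sign_vectors_close_le {r : ℕ} (z : Fin r → ℝ) (hz : z = 0 ∨ (r : ℝ) ≤ ∑ k, z k ^ 2) :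
    (#{q ∈ Fintype.piFinset fun _ : Fin r => ({-1, 1} : Finset ℝ) |
      ∑ k, (z k + q k) ^ 2 < (r : ℝ)} : ℝ) ≤ 2 ^ r * Real.exp (-(r / 8)) := by
  set cube := Fintype.piFinset fun _ : Fin r => ({-1, 1} : Finset ℝ)
  have norm_sq (q) (hq : q ∈ cube) : ∑ k, q k ^ 2 = r := by
    have (k : Fin r) : q k ^ 2 = 1 := by
      have := Fintype.mem_piFinset.1 hq k
      rw [mem_insert, mem_singleton] at this
      rcases this with h | h <;> simp [h]
    simp [this]
  rcases hz with rfl | hz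
  · rw [filter_eq_empty_iff.2 fun q hq => by simp [norm_sq q hq]]
    simp only [card_empty, Nat.cast_zero]
    positivity
  have mgf : ∑ q ∈ cube, Real.exp (-(∑ k, z k * q k) / 2) ≤
      2 ^ r * Real.exp ((∑ k, z k ^ 2) / 8) := by
    have factor (q : Fin r → ℝ) :
        Real.exp (-(∑ k, z k * q k) / 2) = ∏ k, Real.exp (-(z k * q k) / 2) := by
      rw [← Real.exp_sum, ← sum_neg_distrib, sum_div]
    simp_rw [factor]
    rw [← prod_univ_sum (fun _ : Fin r => ({-1, 1} : Finset ℝ))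
      (fun k t => Real.exp (-(z k * t) / 2)), sum_div, Real.exp_sum]
    have : (2 : ℝ) ^ r * ∏ k, Real.exp (z k ^ 2 / 8) = ∏ k, (2 * Real.exp (z k ^ 2 / 8)) := by
      simp [prod_mul_distrib]
    rw [this]
    refine prod_le_prod (fun k _ => by positivity) fun k _ => ?_
    rw [sum_pair (by norm_num)]
    have := Real.cosh_le_exp_half_sq (z k / 2)
    rw [Real.cosh_eq] at this
    have e1 : -(z k * -1) / 2 = z k / 2 := by ring
    have e2 : -(z k * 1) / 2 = -(z k / 2) := by ring
    have e3 : (z k / 2) ^ 2 / 2 = z k ^ 2 / 8 := by ring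
    rw [e1, e2]
    rw [e3] at this
    linarith
  have markov : (#{q ∈ cube | ∑ k, (z k + q k) ^ 2 < (r : ℝ)} : ℝ) * Real.exp ((∑ k, z k ^ 2) / 4) ≤
      ∑ q ∈ cube, Real.exp (-(∑ k, z k * q k) / 2) := by
    rw [← nsmul_eq_mul, ← sum_const]
    refine (sum_le_sum fun q hq => ?_).trans
      (sum_le_sum_of_subset_of_nonneg (filter_subset _ _) fun _ _ _ => (Real.exp_pos _).le)
    obtain ⟨hq, hlt⟩ := mem_filter.1 hq
    have expand : ∑ k, (z k + q k) ^ 2 = ∑ k, z k ^ 2 + 2 * ∑ k, z k * q k + ∑ k, q k ^ 2 := by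
      rw [mul_sum, ← sum_add_distrib, ← sum_add_distrib]
      exact sum_congr rfl fun k _ => by ring
    rw [expand, norm_sq q hq] at hlt
    exact Real.exp_le_exp.2 (by linarith)
  rw [← le_div_iff₀ (Real.exp_pos _)] at markov
  calc _ ≤ _ := markov
    _ ≤ 2 ^ r * Real.exp ((∑ k, z k ^ 2) / 8) / Real.exp ((∑ k, z k ^ 2) / 4) := by gcongr
    _ = 2 ^ r * Real.exp (-((∑ k, z k ^ 2) / 8)) := by
        rw [mul_div_assoc, ← Real.exp_sub]
        congr 2
        ring
    _ ≤ _ := by gcongr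

theorem card_sparse_le {M N D : ℕ} (hMN : M ≤ N) (hN : 1 ≤ N) :
    (#{ε ∈ Fintype.piFinset fun _ : Fin M => ({-1, 0, 1} : Finset ℝ) | #{b | ε b ≠ 0} ≤ D} : ℝ) ≤
      N ^ D * Real.exp 2 := by
  have hN' : (1 : ℝ) ≤ N := by exact_mod_cast hN
  have weight (ε : Fin M → ℝ) (hε : #{b | ε b ≠ 0} ≤ D) :
      1 ≤ (N : ℝ) ^ D * ∏ b, (if ε b = 0 then 1 else (N : ℝ)⁻¹) := by
    rw [prod_ite, prod_const_one, one_mul, prod_const, inv_pow, ← div_eq_mul_inv,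
      one_le_div (by positivity)]
    exact pow_le_pow_right₀ hN' hε
  rw [← nsmul_one, ← sum_const]
  calc _ ≤ ∑ ε ∈ Fintype.piFinset fun _ : Fin M => ({-1, 0, 1} : Finset ℝ),
          (N : ℝ) ^ D * ∏ b, (if ε b = 0 then 1 else (N : ℝ)⁻¹) := by
        refine (sum_le_sum fun ε hε => weight ε (mem_filter.1 hε).2).trans
          (sum_le_sum_of_subset_of_nonneg (filter_subset _ _) fun _ _ _ => ?_)
        refine mul_nonneg (by positivity) (prod_nonneg fun b _ => ?_)
        split_ifs <;> positivity
    _ = (N : ℝ) ^ D * (1 + 2 * (N : ℝ)⁻¹) ^ M := by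
        rw [← mul_sum, ← prod_univ_sum (fun _ : Fin M => ({-1, 0, 1} : Finset ℝ))
          (fun _ t => if t = 0 then (1 : ℝ) else (N : ℝ)⁻¹)]
        rw [prod_const, card_univ, Fintype.card_fin, sum_insert (by norm_num),
          sum_pair (by norm_num)]
        norm_num
        left
        congr 1
        ring
    _ ≤ _ := by
        gcongr
        calc (1 + 2 * (N : ℝ)⁻¹) ^ M ≤ Real.exp (2 * (N : ℝ)⁻¹) ^ M := by
              gcongr
              linarith [Real.add_one_le_exp (2 * (N : ℝ)⁻¹)]
          _ = Real.exp (M * (2 * (N : ℝ)⁻¹)) := by rw [← Real.exp_nat_mul]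
          _ ≤ Real.exp 2 := by
              gcongr
              have : (M : ℝ) ≤ N := by exact_mod_cast hMN
              rw [mul_left_comm, ← div_eq_mul_inv]
              have := (div_le_one (by positivity)).2 this
              linarith

/-- There are `N` sign vectors of length `r` all of whose nontrivial signed sums with at most
`D` terms are at least as long as a single sign vector. -/
theorem exists_sign_vectors {N D r : ℕ} (hN : 1 ≤ N)
    (h : (N : ℝ) ^ D * Real.exp 2 < Real.exp (r / 8)) :
    ∃ p : Fin N → Fin r → ℝ, (∀ b k, p b k = -1 ∨ p b k = 1) ∧
      ∀ ε : Fin N → ℝ, (∀ b, ε b = -1 ∨ ε b = 0 ∨ ε b = 1) → ε ≠ 0 → #{b | ε b ≠ 0} ≤ D →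
        (r : ℝ) ≤ ∑ k, (∑ b, ε b * p b k) ^ 2 := by
  suffices H : ∀ M ≤ N, ∃ p : Fin M → Fin r → ℝ, (∀ b k, p b k = -1 ∨ p b k = 1) ∧
      ∀ ε : Fin M → ℝ, (∀ b, ε b = -1 ∨ ε b = 0 ∨ ε b = 1) → ε ≠ 0 → #{b | ε b ≠ 0} ≤ D →
        (r : ℝ) ≤ ∑ k, (∑ b, ε b * p b k) ^ 2 from H N le_rfl
  intro M
  induction M with
  | zero => exact fun _ => ⟨fun b => b.elim0, fun b => b.elim0,
      fun ε _ hε => (hε (Subsingleton.elim _ _)).elim⟩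
  | succ M ih =>
    intro hM
    obtain ⟨p, hp, hsep⟩ := ih (by omega)
    set cube := Fintype.piFinset fun _ : Fin r => ({-1, 1} : Finset ℝ) with cube_def
    set sparse := {ε ∈ Fintype.piFinset fun _ : Fin M => ({-1, 0, 1} : Finset ℝ) |
      #{b | ε b ≠ 0} ≤ D} with sparse_def
    have mem_sparse (ε : Fin M → ℝ) :
        ε ∈ sparse ↔ (∀ b, ε b = -1 ∨ ε b = 0 ∨ ε b = 1) ∧ #{b | ε b ≠ 0} ≤ D := by
      simp [sparse_def]
    let close : (Fin M → ℝ) → Finset (Fin r → ℝ) := fun ε =>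
      {q ∈ cube | ∑ k, (∑ b, ε b * p b k + q k) ^ 2 < (r : ℝ)}
    have close_card (ε) (hε : ε ∈ sparse) : (#(close ε) : ℝ) ≤ 2 ^ r * Real.exp (-(r / 8)) := by
      refine card_sign_vectors_close_le (fun k => ∑ b, ε b * p b k) ?_
      rw [mem_sparse] at hε
      by_cases h0 : ε = 0
      · left
        ext k
        simp [h0]
      · exact Or.inr (hsep ε hε.1 h0 hε.2)
    have few : #(sparse.biUnion close) < #cube := by
      have : (#(sparse.biUnion close) : ℝ) < 2 ^ r := by
        calc (#(sparse.biUnion close) : ℝ) ≤ ∑ ε ∈ sparse, (#(close ε) : ℝ) := by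
              exact_mod_cast card_biUnion_le
          _ ≤ #sparse * (2 ^ r * Real.exp (-(r / 8))) := by
              rw [← nsmul_eq_mul]
              exact sum_le_card_nsmul _ _ _ close_card
          _ ≤ (N ^ D * Real.exp 2) * (2 ^ r * Real.exp (-(r / 8))) := by
              gcongr
              exact card_sparse_le (by omega) hN
          _ < Real.exp (r / 8) * (2 ^ r * Real.exp (-(r / 8))) := by gcongr
          _ = 2 ^ r := by rw [mul_left_comm, ← Real.exp_add]; simp
      have card_cube : #cube = 2 ^ r := by
        rw [cube_def, Fintype.card_piFinset_const, card_pair (by norm_num)]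
      rw [card_cube]
      exact_mod_cast this
    obtain ⟨q, hq, hfar⟩ := exists_mem_notMem_of_card_lt_card few
    have far (ε) (hε : ε ∈ sparse) : (r : ℝ) ≤ ∑ k, (∑ b, ε b * p b k + q k) ^ 2 := by
      by_contra! hlt
      exact hfar (mem_biUnion.2 ⟨ε, hε, mem_filter.2 ⟨hq, hlt⟩⟩)
    refine ⟨Fin.snoc p q, fun b => ?_, fun ε hε hne hcard => ?_⟩
    · refine Fin.lastCases ?_ (fun b => ?_) b
      · simpa [cube_def] using hq
      · simpa using hp b
    simp only [Fin.sum_univ_castSucc, Fin.snoc_castSucc, Fin.snoc_last]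
    have init_card : #{b : Fin M | ε b.castSucc ≠ 0} ≤ D := by
      refine le_trans ?_ hcard
      refine card_le_card_of_injOn Fin.castSucc (fun b hb => ?_)
        (Fin.castSucc_injective M).injOn
      simpa using hb
    rcases hε (Fin.last M) with hl | hl | hl
    · have := far (fun b => -ε b.castSucc) ((mem_sparse _).2 ⟨fun b => ?_, by simpa using init_card⟩)
      · refine this.trans_eq (sum_congr rfl fun k _ => ?_)
        simp only [hl, neg_mul, sum_neg_distrib]
        ring
      · rcases hε b.castSucc with h | h | h <;> simp [h]
    · simp only [hl, zero_mul, add_zero]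
      refine hsep (fun b => ε b.castSucc) (fun b => hε _) (fun h0 => hne ?_) init_card
      ext b
      refine Fin.lastCases hl (fun b => congrFun h0 b) b
    · simp only [hl, one_mul]
      exact far (fun b => ε b.castSucc) ((mem_sparse _).2 ⟨fun b => hε _, init_card⟩)

theorem exists_not_selectivelyBalancing_of_card_le {ι κ : Type*} [Fintype ι] [Fintype κ]
    (v : ι → EuclideanSpace ℝ κ) (hv : ∀ i, ‖v i‖ = 1)
    (hsep : ∀ ε : ι → ℝ, (∀ i, ε i = -1 ∨ ε i = 0 ∨ ε i = 1) → ε ≠ 0 → 1 ≤ ‖∑ i, ε i • v i‖)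
    {m n : ℕ} (hm : m ≤ Fintype.card ι) (hn : Fintype.card κ = n) :
    ∃ u : Fin m → EuclideanSpace ℝ (Fin n), (∀ i, ‖u i‖ = 1) ∧ ¬ SelectivelyBalancing u := by
  classical
  obtain ⟨g⟩ : Nonempty (Fin m ↪ ι) := by
    rw [Function.Embedding.nonempty_iff_card_le]
    simpa using hm
  let T := LinearIsometryEquiv.piLpCongrLeft 2 ℝ ℝ (Fintype.equivFinOfCardEq hn)
  refine ⟨fun j => T (v (g j)), fun j => by rw [LinearIsometryEquiv.norm_map, hv], ?_⟩
  rintro ⟨ε, hε, hne, hlt⟩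
  have sum_eq : ∑ j, ε j • T (v (g j)) = T (∑ i, Function.extend g ε 0 i • v i) := by
    rw [← sum_subset (subset_univ (univ.map g)), sum_map, map_sum]
    · simp [g.injective.extend_apply]
    · intro i _ hi
      rw [Function.extend_apply' _ _ _ (by simpa using hi), Pi.zero_apply, zero_smul]
  rw [sum_eq, LinearIsometryEquiv.norm_map] at hlt
  refine hlt.not_ge (hsep _ (fun i => ?_) fun h0 => hne ?_)
  · by_cases hi : ∃ j, g j = i
    · obtain ⟨j, rfl⟩ := hi
      rw [g.injective.extend_apply]
      exact hε j
    · simp [Function.extend_apply' _ _ _ hi]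
  · ext j
    rw [← g.injective.extend_apply ε 0 j, h0]
    rfl

/-- A signed sum of powers of two is at least as large as its least term. -/
theorem four_pow_le_sq_sum {L : ℕ} {e : Fin L → ℝ} (he : ∀ i, e i = -1 ∨ e i = 0 ∨ e i = 1)
    {j : Fin L} (hj : e j ≠ 0) (hlt : ∀ i < j, e i = 0) :
    (4 : ℝ) ^ (j : ℕ) ≤ (∑ i, e i * 2 ^ (i : ℕ)) ^ 2 := by
  have (i : Fin L) : ∃ z : ℤ, (z : ℝ) = e i := by
    rcases he i with h | h | h
    exacts [⟨-1, by simp [h]⟩, ⟨0, by simp [h]⟩, ⟨1, by simp [h]⟩]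
  choose z hz using this
  have zj : z j = -1 ∨ z j = 1 := by
    have := he j
    rw [← hz j] at this hj
    norm_cast at this hj
    tauto
  have rest : (2 : ℤ) ^ ((j : ℕ) + 1) ∣ ∑ i ∈ univ.erase j, z i * 2 ^ (i : ℕ) := by
    refine dvd_sum fun i hi => ?_
    rcases lt_or_gt_of_ne (ne_of_mem_erase hi) with h | h
    · have := hlt i h
      rw [← hz i] at this
      norm_cast at this
      simp [this]
    · exact Dvd.dvd.mul_left (pow_dvd_pow _ h) _
  obtain ⟨q, hq⟩ := rest
  have sum_eq : ∑ i, e i * 2 ^ (i : ℕ) = ((2 ^ (j : ℕ) * (z j + 2 * q) : ℤ) : ℝ) := by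
    have : ∑ i, z i * 2 ^ (i : ℕ) = 2 ^ (j : ℕ) * (z j + 2 * q) := by
      rw [← add_sum_erase _ _ (mem_univ j), hq]
      ring
    rw [← this]
    push_cast
    simp [hz]
  have odd : 1 ≤ (z j + 2 * q) ^ 2 := by
    have ne : z j + 2 * q ≠ 0 := by omega
    have pos : 0 < (z j + 2 * q) ^ 2 := by positivity
    linarith
  rw [sum_eq]
  have : (4 : ℤ) ^ (j : ℕ) ≤ (2 ^ (j : ℕ) * (z j + 2 * q)) ^ 2 := by
    rw [mul_pow, ← pow_mul, mul_comm _ 2, pow_mul, show (2 : ℤ) ^ 2 = 4 by norm_num]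
    exact le_mul_of_one_le_right (by positivity) odd
  exact_mod_cast this

/-- On level `i`, the unit vectors consist of the scaled standard basis `2 ^ (i - L) • e_b` and,
in a separate block of `r` coordinates, of scaled copies of the sign vectors from
`exists_sign_vectors`. -/
theorem exists_not_selectivelyBalancing {N L r m : ℕ} (hN : 1 ≤ N)
    (h : (N : ℝ) ^ 4 ^ L * Real.exp 2 < Real.exp (r / 8)) (hm : m ≤ L * N) :
    ∃ u : Fin m → EuclideanSpace ℝ (Fin (N + L * r)),
      (∀ i, ‖u i‖ = 1) ∧ ¬ SelectivelyBalancing u := by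
  have hr : (0 : ℝ) < r := by
    rcases Nat.eq_zero_or_pos r with rfl | hr
    · have h1 : (1 : ℝ) ≤ (N : ℝ) ^ 4 ^ L := one_le_pow₀ (by exact_mod_cast hN)
      have h2 : (1 : ℝ) < Real.exp 2 := by simp
      simp only [Nat.cast_zero, zero_div, Real.exp_zero] at h
      nlinarith
    · exact_mod_cast hr
  obtain ⟨p, hp, hsep⟩ := exists_sign_vectors hN h
  let c : Fin L → ℝ := fun i => 2 ^ (i : ℕ) / 2 ^ L
  have c_sq (i) : c i ^ 2 = 4 ^ (i : ℕ) / 4 ^ L := by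
    simp only [c, div_pow, ← pow_mul, mul_comm _ 2]
    norm_num [pow_mul]
  have c_sq_le (i) : c i ^ 2 ≤ 1 := by
    rw [c_sq, div_le_one (by positivity)]
    exact pow_le_pow_right₀ (by norm_num) i.2.le
  let s : Fin L → ℝ := fun i => √((1 - c i ^ 2) / r)
  have s_sq (i) : s i ^ 2 * r = 1 - c i ^ 2 := by
    rw [Real.sq_sqrt (div_nonneg (by linarith [c_sq_le i]) hr.le), div_mul_cancel₀ _ hr.ne']
  let v : Fin L × Fin N → EuclideanSpace ℝ (Fin N ⊕ Fin L × Fin r) := fun x =>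
    WithLp.toLp 2 (Sum.elim (fun b => if x.2 = b then c x.1 else 0)
      fun y => if x.1 = y.1 then s x.1 * p x.2 y.2 else 0)
  have p_sq (b k) : p b k ^ 2 = 1 := by rcases hp b k with h | h <;> simp [h]
  refine exists_not_selectivelyBalancing_of_card_le v (fun x => ?_) (fun ε hε hne => ?_)
    (by simpa using hm) (by simp)
  · rw [← sq_eq_sq₀ (norm_nonneg _) zero_le_one, EuclideanSpace.real_norm_sq_eq]
    simp only [v, Fintype.sum_sum_type, Sum.elim_inl, Sum.elim_inr, Fintype.sum_prod_type, ite_pow,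
      mul_pow, p_sq]
    simp only [ne_eq, OfNat.ofNat_ne_zero, not_false_eq_true, zero_pow, sum_ite_eq, mem_univ,
      if_true, mul_one, mul_ite, mul_zero, sum_const, card_univ, Fintype.card_fin,
      nsmul_eq_mul]
    linarith [s_sq x.1]
  have norm_sq : ‖∑ x, ε x • v x‖ ^ 2 = ∑ b, (∑ i, ε (i, b) * c i) ^ 2 +
      ∑ i, s i ^ 2 * ∑ k, (∑ b, ε (i, b) * p b k) ^ 2 := by
    rw [EuclideanSpace.real_norm_sq_eq, Fintype.sum_sum_type, Fintype.sum_prod_type]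
    simp only [v, WithLp.ofLp_sum, WithLp.ofLp_smul, Finset.sum_apply, Pi.smul_apply, smul_eq_mul,
      Sum.elim_inl, Sum.elim_inr, Fintype.sum_prod_type, mul_ite, mul_zero]
    congr 1
    · simp
    · refine sum_congr rfl fun i _ => ?_
      rw [mul_sum]
      refine sum_congr rfl fun k _ => ?_
      rw [sum_comm]
      simp only [sum_ite_eq', mem_univ, if_true]
      rw [← mul_pow, mul_sum]
      congr 1
      exact sum_congr rfl fun b _ => by ring
  obtain ⟨j, ⟨b₀, hj⟩, hmin⟩ : ∃ j, (∃ b, ε (j, b) ≠ 0) ∧ ∀ i < j, ∀ b, ε (i, b) = 0 := by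
    have nonempty : ({i | ∃ b, ε (i, b) ≠ 0} : Finset (Fin L)).Nonempty := by
      obtain ⟨x, hx⟩ := Function.ne_iff.1 hne
      exact ⟨x.1, by simpa using ⟨x.2, hx⟩⟩
    refine ⟨_, (mem_filter.1 (min'_mem _ nonempty)).2, fun i hi b => ?_⟩
    by_contra hb
    exact (min'_le _ i (by simpa using ⟨b, hb⟩)).not_gt hi
  set t := #{b | ε (j, b) ≠ 0} with t_def
  have basis_part : t * c j ^ 2 ≤ ∑ b, (∑ i, ε (i, b) * c i) ^ 2 := by
    rw [t_def, ← nsmul_eq_mul, ← sum_const, sum_filter]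
    refine sum_le_sum fun b _ => ?_
    split_ifs with hb
    · have := four_pow_le_sq_sum (e := fun i => ε (i, b)) (fun i => hε _) hb
        fun i hi => hmin i hi b
      have scale : ∑ i, ε (i, b) * c i = (∑ i, ε (i, b) * 2 ^ (i : ℕ)) / 2 ^ L := by
        rw [sum_div]
        exact sum_congr rfl fun i _ => by simp only [c]; ring
      rw [scale, c_sq, div_pow, ← pow_mul 2 L 2, mul_comm L 2, pow_mul 2 2 L]
      norm_num
      gcongr
    · positivity
  have sign_part_nonneg (i) : 0 ≤ s i ^ 2 * ∑ k, (∑ b, ε (i, b) * p b k) ^ 2 :=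
    mul_nonneg (sq_nonneg _) (sum_nonneg fun k _ => sq_nonneg _)
  have sign_part := single_le_sum (fun i _ => sign_part_nonneg i) (mem_univ j)
  rw [← one_le_sq_iff₀ (norm_nonneg _), norm_sq]
  rcases le_or_gt t (4 ^ L) with ht | ht
  · have t_pos : (1 : ℝ) ≤ t := by
      have : 0 < t := card_pos.2 ⟨b₀, by simpa using hj⟩
      exact_mod_cast this
    have := hsep (fun b => ε (j, b)) (fun b => hε _) (fun h0 => hj (congrFun h0 b₀)) ht
    have := mul_le_mul_of_nonneg_left this (sq_nonneg (s j))
    rw [s_sq] at this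
    nlinarith [sq_nonneg (c j)]
  · have := sum_nonneg fun i (_ : i ∈ univ) => sign_part_nonneg i
    have one_le : 1 ≤ t * c j ^ 2 := by
      rw [c_sq, ← mul_div_assoc, one_le_div (by positivity)]
      have h1 : (4 : ℝ) ^ L ≤ t := by exact_mod_cast ht.le
      have h2 : (1 : ℝ) ≤ 4 ^ (j : ℕ) := one_le_pow₀ (by norm_num)
      nlinarith
    linarith

theorem sigma'_le {n m : ℕ} (h : 2 * (√(2 * m) + 1) ^ n < (2 : ℝ) ^ m) : sigma' n ≤ m :=
  Nat.sInf_le fun u hu => selectivelyBalancing_of_lt h u hu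

theorem le_sigma' {N L r : ℕ} (hN : 1 ≤ N)
    (h : (N : ℝ) ^ 4 ^ L * Real.exp 2 < Real.exp (r / 8))
    (hne : ∃ m : ℕ, 2 * (√(2 * m) + 1) ^ (N + L * r) < (2 : ℝ) ^ m) :
    L * N ≤ sigma' (N + L * r) := by
  obtain ⟨m₀, hm₀⟩ := hne
  refine le_csInf ⟨m₀, fun u hu => selectivelyBalancing_of_lt hm₀ u hu⟩ fun m hm => ?_
  by_contra! hlt
  obtain ⟨u, hu, hnot⟩ := exists_not_selectivelyBalancing hN h hlt.le
  exact hnot (hm u hu)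

theorem tendsto_log_div_rpow {s : ℝ} (hs : 0 < s) :
    Tendsto (fun n : ℕ => Real.log n / (n : ℝ) ^ s) atTop (𝓝 0) :=
  (isLittleO_log_rpow_atTop hs).tendsto_div_nhds_zero.comp tendsto_natCast_atTop_atTop

theorem tendsto_logb_natCast : Tendsto (fun n : ℕ => Real.logb 2 n) atTop atTop :=
  (Real.tendsto_logb_atTop one_lt_two).comp tendsto_natCast_atTop_atTop

theorem tendsto_mul_logb_natCast : Tendsto (fun n : ℕ => n * Real.logb 2 n) atTop atTop :=
  tendsto_natCast_atTop_atTop.atTop_mul_atTop₀ tendsto_logb_natCast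

theorem eventually_volume_bound {c : ℝ} (hc : 1 / 2 < c) :
    ∀ᶠ n : ℕ in atTop, 2 * (√(2 * (⌊c * (n * Real.logb 2 n)⌋₊ + 1 : ℕ)) + 1) ^ n <
      (2 : ℝ) ^ (⌊c * (n * Real.logb 2 n)⌋₊ + 1) := by
  obtain ⟨d, hd, hdc⟩ := exists_between hc
  have small : Tendsto (fun n : ℕ => 8 * (c / Real.log 2 * (Real.log n / (n : ℝ) ^ (2 * d - 1)) +
      ((n : ℝ) ^ (2 * d))⁻¹)) atTop (𝓝 (8 * (c / Real.log 2 * 0 + 0))) :=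
    (((tendsto_log_div_rpow (by linarith)).const_mul _).add (tendsto_inv_atTop_zero.comp
      ((tendsto_rpow_atTop (by linarith)).comp tendsto_natCast_atTop_atTop))).const_mul _
  have two_le : ∀ᶠ n : ℕ in atTop, 2 ≤ (n : ℝ) ^ d :=
    ((tendsto_rpow_atTop (by linarith)).comp tendsto_natCast_atTop_atTop).eventually_ge_atTop 2
  have gap : ∀ᶠ n : ℕ in atTop, 1 ≤ (c - d) * (n * Real.logb 2 n) :=
    (tendsto_mul_logb_natCast.const_mul_atTop (by linarith)).eventually_ge_atTop 1
  filter_upwards [small.eventually_lt_const (u := 1) (by norm_num), two_le, gap,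
    eventually_gt_atTop 1] with n h1 h2 h3 hn
  have n_pos : (0 : ℝ) < n := by positivity
  set x := n * Real.logb 2 n with x_def
  have x_nonneg : 0 ≤ x :=
    mul_nonneg n_pos.le (Real.logb_nonneg one_lt_two (by exact_mod_cast hn.le))
  set m := ⌊c * x⌋₊ + 1 with m_def
  have m_le : (m : ℝ) ≤ c * x + 1 := by
    rw [m_def]
    push_cast
    linarith [Nat.floor_le (by positivity : 0 ≤ c * x)]
  have lt_m : c * x < m := by
    rw [m_def]
    push_cast
    exact Nat.lt_floor_add_one _
  have sqrt_le : √(2 * m) + 1 ≤ (n : ℝ) ^ d := by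
    have split : (n : ℝ) ^ (2 * d) = n ^ (2 * d - 1) * n := by
      rw [Real.rpow_sub_one n_pos.ne', div_mul_cancel₀ _ n_pos.ne']
    have bound : 8 * (c * x + 1) ≤ (n : ℝ) ^ (2 * d) := by
      have : 8 * (c * x + 1) = 8 * (c / Real.log 2 * (Real.log n / (n : ℝ) ^ (2 * d - 1)) +
          ((n : ℝ) ^ (2 * d))⁻¹) * (n : ℝ) ^ (2 * d) := by
        rw [split, x_def, Real.logb]
        have := Real.log_pos one_lt_two
        have := Real.rpow_pos_of_pos n_pos (2 * d - 1)
        field_simp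
      rw [this]
      exact mul_le_of_le_one_left (by positivity) h1.le
    have : √(2 * m) ≤ (n : ℝ) ^ d / 2 := by
      refine Real.sqrt_le_iff.2 ⟨by positivity, ?_⟩
      rw [div_pow, ← Real.rpow_natCast, ← Real.rpow_mul n_pos.le, Nat.cast_two, mul_comm d]
      linarith
    linarith
  calc 2 * (√(2 * m) + 1) ^ n ≤ 2 * ((n : ℝ) ^ d) ^ n := by gcongr
    _ = (2 : ℝ) ^ (1 + d * x) := by
        have : d * x = Real.logb 2 n * (d * n) := by rw [x_def]; ring
        rw [Real.rpow_add two_pos, Real.rpow_one, this, Real.rpow_mul zero_le_two,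
          Real.rpow_logb two_pos (by norm_num) n_pos, Real.rpow_mul n_pos.le, Real.rpow_natCast]
    _ < (2 : ℝ) ^ (m : ℝ) := Real.rpow_lt_rpow_of_exponent_lt one_lt_two (by linarith)
    _ = 2 ^ m := Real.rpow_natCast _ _

theorem eventually_lt_sigma'_div {a : ℝ} (ha : a < 1 / 2) :
    ∀ᶠ n : ℕ in atTop, a < (sigma' n : ℝ) / (n * Real.logb 2 n) := by
  obtain ⟨c, hac, hc⟩ := exists_between (max_lt ha (by norm_num : (0 : ℝ) < 1 / 2))
  rw [max_lt_iff] at hac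
  obtain ⟨hac, c_pos⟩ := hac
  let L : ℕ → ℕ := fun n => ⌊c * Real.logb 2 n⌋₊
  let r : ℕ → ℕ := fun n => ⌈8 * (4 ^ L n * Real.log n + 2)⌉₊ + 1
  have blocks_small : Tendsto (fun n : ℕ => (L n * r n : ℝ) / n) atTop (𝓝 0) := by
    have bound : Tendsto (fun n : ℕ => 8 * (c / Real.log 2) *
        (Real.log n / (n : ℝ) ^ ((1 - 2 * c) / 2)) ^ 2 +
        18 * (c / Real.log 2) * (Real.log n / (n : ℝ) ^ (1 : ℝ))) atTop
        (𝓝 (8 * (c / Real.log 2) * 0 ^ 2 + 18 * (c / Real.log 2) * 0)) :=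
      (((tendsto_log_div_rpow (by linarith)).pow 2).const_mul _).add
        ((tendsto_log_div_rpow one_pos).const_mul _)
    norm_num only [mul_zero, zero_pow, add_zero] at bound
    refine tendsto_of_tendsto_of_tendsto_of_le_of_le' tendsto_const_nhds bound
      (Eventually.of_forall fun n => by positivity) ?_
    filter_upwards [eventually_gt_atTop 1] with n hn
    have n_pos : (0 : ℝ) < n := by positivity
    have log_nonneg : 0 ≤ Real.log n := Real.log_natCast_nonneg n
    have logb_nonneg : 0 ≤ Real.logb 2 n := Real.logb_nonneg one_lt_two (by exact_mod_cast hn.le)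
    have L_le : (L n : ℝ) ≤ c * Real.logb 2 n := Nat.floor_le (by positivity)
    have pow_le : (4 : ℝ) ^ L n ≤ (n : ℝ) ^ (2 * c) := by
      calc (4 : ℝ) ^ L n = 2 ^ (2 * (L n : ℝ)) := by
            rw [Real.rpow_mul zero_le_two, Real.rpow_natCast]
            norm_num
        _ ≤ 2 ^ (Real.logb 2 n * (2 * c)) :=
            Real.rpow_le_rpow_of_exponent_le one_le_two (by linarith)
        _ = (n : ℝ) ^ (2 * c) := by
            rw [Real.rpow_mul zero_le_two, Real.rpow_logb two_pos (by norm_num) n_pos]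
    have r_le : (r n : ℝ) ≤ 8 * (n : ℝ) ^ (2 * c) * Real.log n + 18 := by
      have h1 := Nat.ceil_lt_add_one (by positivity : 0 ≤ 8 * (4 ^ L n * Real.log n + 2))
      have h2 := mul_le_mul_of_nonneg_right pow_le log_nonneg
      simp only [r]
      push_cast
      linarith
    calc (L n * r n : ℝ) / n
        ≤ (c * Real.logb 2 n) * (8 * (n : ℝ) ^ (2 * c) * Real.log n + 18) / n := by gcongr
      _ = _ := by
        have e1 : ((n : ℝ) ^ ((1 - 2 * c) / 2)) ^ 2 = n / (n : ℝ) ^ (2 * c) := by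
          rw [← Real.rpow_natCast, ← Real.rpow_mul n_pos.le, ← Real.rpow_one_sub' n_pos.le]
          · congr 1
            push_cast
            ring
          · linarith
        rw [div_pow, e1, Real.rpow_one, Real.logb]
        have := Real.log_pos one_lt_two
        have := Real.rpow_pos_of_pos n_pos (2 * c)
        field_simp
  have ratio : Tendsto (fun n : ℕ => (L n : ℝ) / Real.logb 2 n * (1 - (L n * r n : ℝ) / n))
      atTop (𝓝 (c * (1 - 0))) :=
    ((tendsto_nat_floor_mul_div_atTop c_pos.le).comp tendsto_logb_natCast).mul
      (tendsto_const_nhds.sub blocks_small)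
  filter_upwards [ratio.eventually_const_lt (by simpa using hac),
    blocks_small.eventually_lt_const one_pos, eventually_gt_atTop 1,
    eventually_volume_bound (c := 1) (by norm_num)] with n h1 h2 hn h3
  have n_pos : (0 : ℝ) < n := by positivity
  have logb_pos : 0 < Real.logb 2 n := Real.logb_pos one_lt_two (by exact_mod_cast hn)
  rw [div_lt_one n_pos] at h2
  have blocks_lt : L n * r n < n := by exact_mod_cast h2
  have dim_eq : n - L n * r n + L n * r n = n := Nat.sub_add_cancel blocks_lt.le
  have N_le : ((n - L n * r n : ℕ) : ℝ) ≤ n := by exact_mod_cast Nat.sub_le _ _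
  have key := le_sigma' (N := n - L n * r n) (L := L n) (r := r n) (by omega) (by
    calc ((n - L n * r n : ℕ) : ℝ) ^ 4 ^ L n * Real.exp 2
        ≤ (n : ℝ) ^ 4 ^ L n * Real.exp 2 := by gcongr
      _ = Real.exp (4 ^ L n * Real.log n + 2) := by
          have := Real.exp_nat_mul (Real.log n) (4 ^ L n)
          push_cast at this
          rw [Real.exp_add, this, Real.exp_log n_pos]
      _ < _ := by
          refine Real.exp_lt_exp.2 ?_
          have := Nat.le_ceil (8 * (4 ^ L n * Real.log n + 2))
          simp only [r]
          push_cast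
          linarith) (by
    rw [dim_eq]
    exact ⟨_, h3⟩)
  rw [dim_eq] at key
  refine h1.trans_le ?_
  have key' : (L n : ℝ) * (n - L n * r n) ≤ sigma' n := by
    rw [← Nat.cast_mul (L n) (r n), ← Nat.cast_sub blocks_lt.le]
    exact_mod_cast key
  calc (L n : ℝ) / Real.logb 2 n * (1 - (L n * r n : ℝ) / n)
      = (L n : ℝ) * (n - L n * r n) / (n * Real.logb 2 n) := by field_simp
    _ ≤ _ := by gcongr

theorem eventually_sigma'_div_lt {b : ℝ} (hb : 1 / 2 < b) :
    ∀ᶠ n : ℕ in atTop, (sigma' n : ℝ) / (n * Real.logb 2 n) < b := by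
  obtain ⟨c, hc, hcb⟩ := exists_between hb
  filter_upwards [eventually_volume_bound hc,
    (tendsto_mul_logb_natCast.const_mul_atTop (sub_pos.2 hcb)).eventually_gt_atTop 1,
    tendsto_mul_logb_natCast.eventually_gt_atTop 0] with n h1 h2 h3
  rw [div_lt_iff₀ h3]
  have le : (sigma' n : ℝ) ≤ (⌊c * (n * Real.logb 2 n)⌋₊ + 1 : ℕ) := by
    exact_mod_cast sigma'_le h1
  have floor_le := Nat.floor_le (by positivity : 0 ≤ c * (n * Real.logb 2 n))
  push_cast at le
  linarith

/-- `σ(n) ∼ (1/2) n log₂ n`. -/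
theorem sigma_asymptotic :
    Filter.Tendsto (fun n : ℕ => (sigma' n : ℝ) / (n * Real.logb 2 n))
      Filter.atTop (nhds (1 / 2)) := by
  exact tendsto_order.2 ⟨fun _ => eventually_lt_sigma'_div, fun _ => eventually_sigma'_div_lt⟩
end

section
/- For every constant c_2 < 1/2 there exists N such that for all n ≥ N, there exist at least c_2 · n · log₂(n) unit vectors in R^n that are not selectively balancing. -/
open Finset in
/-- There are at most `n ^ d` binary words of length `n` and weight less than `d`. -/
theorem card_hammingNorm_lt (n d : ℕ) (hn : 2 ≤ n) :
    #{x : Fin n → ZMod 2 | hammingNorm x < d} ≤ n ^ d := by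
  have h1 : #{x : Fin n → ZMod 2 | hammingNorm x < d} ≤
      #((range d).biUnion fun i => powersetCard i (univ : Finset (Fin n))) := by
    refine card_le_card_of_injOn (fun x => ({i | x i ≠ 0} : Finset (Fin n))) ?_ ?_
    · intro x hx
      simpa [hammingNorm] using hx
    · intro x _ y _ hxy
      funext i
      have h := Finset.ext_iff.1 hxy i
      simp only [mem_filter, mem_univ, true_and] at h
      generalize x i = a at h
      generalize y i = b at h
      revert a b
      decide
  refine h1.trans (card_biUnion_le.trans ?_)
  refine le_trans (Finset.sum_le_sum fun i _ => ?_) (Nat.geomSum_lt (m := n) (n := d)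
    (s := range d) hn (by simp)).le
  simpa using Nat.choose_le_pow n i

/-- A word of weight at least `d` agrees with a word of weight exactly `d` on the support
of the latter. -/
theorem exists_hammingNorm_eq_sub {n d : ℕ} (x : Fin n → ZMod 2) (hx : d ≤ hammingNorm x) :
    ∃ v : Fin n → ZMod 2, hammingNorm v = d ∧ hammingNorm (x - v) + d = hammingNorm x := by
  classical
  obtain ⟨T, hT, hTd⟩ := Finset.exists_subset_card_eq hx
  have hT' : ∀ i ∈ T, x i ≠ 0 := fun i hi => by simpa using hT hi
  refine ⟨fun i => if i ∈ T then x i else 0, ?_, ?_⟩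
  · rw [← hTd]
    unfold hammingNorm
    congr 1
    ext i
    by_cases hi : i ∈ T <;> simp [hi, hT']
  · rw [← hTd]
    unfold hammingNorm
    rw [← Finset.card_sdiff_add_card_eq_card hT]
    congr 2
    ext i
    by_cases hi : i ∈ T <;> simp [hi]

/-- If the cosets of a code outnumber the words of weight less than `d`, then some word of
weight `d` has minimum weight in its coset. -/
theorem exists_coset_leader {n d M : ℕ} (c : Fin M → Fin n → ZMod 2)
    (h : (Finset.univ.filter fun x : Fin n → ZMod 2 => hammingNorm x < d).card * 2 ^ M < 2 ^ n) :
    ∃ v : Fin n → ZMod 2, hammingNorm v = d ∧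
      ∀ z : Fin M → ZMod 2, d ≤ hammingNorm (v + ∑ i, z i • c i) := by
  by_contra! hc
  have key : ∀ (k : ℕ) (x : Fin n → ZMod 2), hammingNorm x ≤ k →
      ∃ z : Fin M → ZMod 2, hammingNorm (x + ∑ i, z i • c i) < d := by
    intro k
    induction k with
    | zero =>
      intro x hx
      by_cases hd : hammingNorm x < d
      · exact ⟨0, by simpa using hd⟩
      · exact hc x (by omega)
    | succ k ih =>
      intro x hx
      by_cases hd : hammingNorm x < d
      · exact ⟨0, by simpa using hd⟩
      obtain ⟨v, hv, hxv⟩ := exists_hammingNorm_eq_sub x (not_lt.1 hd)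
      obtain ⟨z, hz⟩ := hc v hv
      have h1 : x + ∑ i, z i • c i = (x - v) + (v + ∑ i, z i • c i) := by abel
      have h2 : hammingNorm ((x - v) + (v + ∑ i, z i • c i)) ≤
          hammingNorm (x - v) + hammingNorm (v + ∑ i, z i • c i) := by
        generalize v + ∑ i, z i • c i = w
        have := hammingDist_triangle (x - v) 0 (-w)
        rw [hammingDist_zero_right, hammingDist_zero_left, hammingDist_eq_hammingNorm] at this
        simpa [hammingNorm, add_comm, sub_eq_add_neg] using this
      obtain ⟨z', hz'⟩ := ih (x + ∑ i, z i • c i) (by rw [h1]; omega)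
      refine ⟨z + z', ?_⟩
      simpa [add_smul, Finset.sum_add_distrib, add_assoc] using hz'
  refine absurd h (not_lt.2 ?_)
  have hcard : (Finset.univ : Finset (Fin n → ZMod 2)).card ≤
      ((Finset.univ.filter fun x : Fin n → ZMod 2 => hammingNorm x < d) ×ˢ
        (Finset.univ : Finset (Fin M → ZMod 2))).card := by
    refine Finset.card_le_card_of_surjOn (fun p => p.1 - ∑ i, p.2 i • c i) ?_
    intro x _
    obtain ⟨z, hz⟩ := key _ x le_rfl
    exact ⟨(x + ∑ i, z i • c i, z), by simpa using hz, by simp⟩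
  simpa [Finset.card_product] using hcard

/-- There is a binary code with minimum distance `d` and codimension at most `d * L`, generated
by words of weight exactly `d`. -/
theorem exists_code {n d L : ℕ} (hn : 2 ≤ n) (hL : n ≤ 2 ^ L) (M : ℕ) (hM : M ≤ n - d * L) :
    ∃ c : Fin M → Fin n → ZMod 2, (∀ i, hammingNorm (c i) = d) ∧
      ∀ z : Fin M → ZMod 2, z ≠ 0 → d ≤ hammingNorm (∑ i, z i • c i) := by
  induction M with
  | zero => exact ⟨Fin.elim0, fun i => i.elim0, fun z hz => absurd (Subsingleton.elim z 0) hz⟩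
  | succ M ih =>
    obtain ⟨c, hc, hc'⟩ := ih (by omega)
    obtain ⟨v, hv, hv'⟩ := exists_coset_leader (d := d) c <| by
      calc _ ≤ n ^ d * 2 ^ M := Nat.mul_le_mul_right _ (card_hammingNorm_lt n d hn)
        _ ≤ (2 ^ L) ^ d * 2 ^ M := by gcongr
        _ = 2 ^ (d * L + M) := by rw [← pow_mul, ← pow_add, mul_comm L d]
        _ < 2 ^ n := Nat.pow_lt_pow_right (by norm_num) (by omega)
    refine ⟨Fin.snoc c v, fun i => ?_, fun z hz => ?_⟩
    · induction i using Fin.lastCases with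
      | last => simpa using hv
      | cast i => simpa using hc i
    · rw [Fin.sum_univ_castSucc]
      simp only [Fin.snoc_castSucc, Fin.snoc_last]
      have h01 : ∀ a : ZMod 2, a = 0 ∨ a = 1 := by decide
      rcases h01 (z (Fin.last M)) with h0 | h1
      · rw [h0, zero_smul, add_zero]
        refine hc' (fun i => z i.castSucc) fun h => hz ?_
        funext i
        induction i using Fin.lastCases with
        | last => exact h0
        | cast i => exact congrFun h i
      · rw [h1, one_smul, add_comm]
        exact hv' fun i => z i.castSucc

/-- A binary word read as a real vector and scaled by `2 ^ (-j)`. -/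
noncomputable def scaledWord {n : ℕ} (j : ℕ) (c : Fin n → ZMod 2) : EuclideanSpace ℝ (Fin n) :=
  WithLp.toLp 2 fun k => (2 ^ j : ℝ)⁻¹ * ((c k).val : ℝ)

theorem norm_scaledWord {n j : ℕ} (c : Fin n → ZMod 2) (hc : hammingNorm c = 4 ^ j) :
    ‖scaledWord j c‖ = 1 := by
  have hval : ∀ a : ZMod 2, ((a.val : ℝ)) ^ 2 = if a ≠ 0 then 1 else 0 := by
    intro a
    have h01 : ∀ a : ZMod 2, a = 0 ∨ a = 1 := by decide
    rcases h01 a with rfl | rfl <;> simp [ZMod.val_one]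
  have h : ‖scaledWord j c‖ ^ 2 = 1 := by
    rw [EuclideanSpace.real_norm_sq_eq]
    simp only [scaledWord, mul_pow, ← Finset.mul_sum, hval, Finset.sum_boole]
    rw [show (Finset.univ.filter fun k => c k ≠ 0).card = 4 ^ j from hc]
    rw [inv_pow, ← pow_mul, mul_comm j 2, pow_mul]
    norm_num
  exact (pow_eq_one_iff_of_nonneg (norm_nonneg _) two_ne_zero).1 h

theorem hammingNorm_intCast_le {n : ℕ} (a : Fin n → ℤ) :
    (hammingNorm (fun k => (a k : ZMod 2)) : ℝ) ≤ ∑ k, (a k : ℝ) ^ 2 := by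
  unfold hammingNorm
  rw [Finset.card_filter]
  push_cast
  refine Finset.sum_le_sum fun k _ => ?_
  split_ifs with h
  · have h0 : a k ≠ 0 := fun h0 => h (by simp [h0])
    have : (1 : ℤ) ≤ (a k) ^ 2 := Int.add_one_le_iff.2 (sq_pos_of_ne_zero h0)
    exact_mod_cast this
  · positivity

/-- Placing a code of minimum distance `4 ^ j` at scale `2 ^ (-j)` for each level `j` yields
vectors all of whose nontrivial signed sums have norm at least one. -/
theorem one_le_norm_sum_scaledWord {n J : ℕ} {M : Fin J → ℕ}
    (c : ∀ j, Fin (M j) → Fin n → ZMod 2)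
    (hc : ∀ j, ∀ z : Fin (M j) → ZMod 2, z ≠ 0 → 4 ^ (j : ℕ) ≤ hammingNorm (∑ i, z i • c j i))
    (e : (Σ j, Fin (M j)) → ℤ) (he : ∀ p, e p = -1 ∨ e p = 0 ∨ e p = 1) (hne : e ≠ 0) :
    1 ≤ ‖∑ p, (e p : ℝ) • scaledWord p.1 (c p.1 p.2)‖ := by
  classical
  obtain ⟨p₀, hp₀⟩ := Function.ne_iff.1 hne
  obtain ⟨q, hq, hmax⟩ := Finset.exists_max_image (Finset.univ.filter fun p => e p ≠ 0)
    (fun p => p.1) ⟨p₀, by simpa using hp₀⟩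
  replace hq : e q ≠ 0 := by simpa using hq
  replace hmax : ∀ p, e p ≠ 0 → p.1 ≤ q.1 := fun p hp => hmax p (by simpa using hp)
  obtain ⟨j, i₀⟩ := q
  dsimp only at hmax
  set a : Fin n → ℤ := fun k =>
    ∑ p : Σ j, Fin (M j), e p * 2 ^ ((j : ℕ) - (p.1 : ℕ)) * ((c p.1 p.2 k).val : ℤ) with ha
  have hcoord : ∀ k, (∑ p, (e p : ℝ) • scaledWord p.1 (c p.1 p.2)) k =
      (2 ^ (j : ℕ) : ℝ)⁻¹ * (a k : ℝ) := by
    intro k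
    simp only [ha, scaledWord, WithLp.ofLp_sum, WithLp.ofLp_smul, Finset.sum_apply,
      Pi.smul_apply, smul_eq_mul]
    push_cast
    rw [Finset.mul_sum]
    refine Finset.sum_congr rfl fun p _ => ?_
    by_cases hp : e p = 0
    · simp [hp]
    · have hle : (p.1 : ℕ) ≤ (j : ℕ) := hmax p hp
      have : (2 : ℝ) ^ (j : ℕ) = 2 ^ ((j : ℕ) - (p.1 : ℕ)) * 2 ^ (p.1 : ℕ) := by
        rw [← pow_add, Nat.sub_add_cancel hle]
      rw [this]
      field_simp
  have hmod : (fun k => (a k : ZMod 2)) = ∑ i, (e ⟨j, i⟩ : ZMod 2) • c j i := by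
    funext k
    simp only [ha, Finset.sum_apply, Pi.smul_apply, smul_eq_mul]
    push_cast
    simp only [ZMod.natCast_val, ZMod.cast_id', id_eq]
    rw [Fintype.sum_sigma, Finset.sum_eq_single j]
    · simp
    · intro j' _ hj'
      refine Finset.sum_eq_zero fun i _ => ?_
      by_cases hp : e ⟨j', i⟩ = 0
      · simp [hp]
      · have hlt : (j' : ℕ) < (j : ℕ) := lt_of_le_of_ne (hmax _ hp) (Fin.val_ne_of_ne hj')
        have h2 : (2 : ZMod 2) = 0 := by decide
        rw [h2, zero_pow (Nat.sub_ne_zero_of_lt hlt)]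
        simp
    · simp
  have hz : (fun i => (e ⟨j, i⟩ : ZMod 2)) ≠ 0 := by
    intro h
    have h' := congrFun h i₀
    rcases he ⟨j, i₀⟩ with h1 | h1 | h1
    · simp [h1] at h'
    · exact hq h1
    · simp [h1] at h'
  have hw := hc j _ hz
  rw [← hmod] at hw
  have hsum : (4 : ℝ) ^ (j : ℕ) ≤ ∑ k, (a k : ℝ) ^ 2 :=
    le_trans (by exact_mod_cast hw) (hammingNorm_intCast_le a)
  have hsq : 1 ≤ ‖∑ p, (e p : ℝ) • scaledWord p.1 (c p.1 p.2)‖ ^ 2 := by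
    rw [EuclideanSpace.real_norm_sq_eq]
    simp only [hcoord, mul_pow, ← Finset.mul_sum]
    rw [inv_pow, ← pow_mul, mul_comm (j : ℕ) 2, pow_mul, ← div_eq_inv_mul,
      le_div_iff₀ (by positivity)]
    norm_num
    exact hsum
  exact (one_le_sq_iff₀ (norm_nonneg _)).1 hsq

theorem injective_of_not_selectivelyBalancing {n m : ℕ} {u : Fin m → EuclideanSpace ℝ (Fin n)}
    (hu : ¬ SelectivelyBalancing u) : Function.Injective u := by
  intro a b hab
  by_contra hne
  refine hu ⟨Pi.single a 1 - Pi.single b 1, fun i => ?_, fun h => ?_, ?_⟩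
  · by_cases hia : i = a
    · subst hia
      simp [hne]
    · by_cases hib : i = b
      · subst hib
        simp [hia]
      · simp [hia, hib]
  · have := congrFun h a
    simp [hne] at this
  · simp [sub_smul, Finset.sum_sub_distrib, Pi.single_apply, hab]

theorem exists_not_selectivelyBalancing_s9 {n L : ℕ} (hn : 2 ≤ n) (hL : n ≤ 2 ^ L) (J : ℕ) :
    ∃ u : Fin (∑ j : Fin J, (n - 4 ^ (j : ℕ) * L)) → EuclideanSpace ℝ (Fin n),
      (∀ i, ‖u i‖ = 1) ∧ ¬ SelectivelyBalancing u := by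
  choose c hc hc' using fun j : Fin J => exists_code (d := 4 ^ (j : ℕ)) hn hL _ le_rfl
  let w : (Σ j : Fin J, Fin (n - 4 ^ (j : ℕ) * L)) → EuclideanSpace ℝ (Fin n) :=
    fun p => scaledWord p.1 (c p.1 p.2)
  refine ⟨fun i => w (finSigmaFinEquiv.symm i), fun i => norm_scaledWord _ (hc _ _), ?_⟩
  rintro ⟨ε, hε, hne, hlt⟩
  have hlift : ∀ i, ∃ e : ℤ, (e : ℝ) = ε i ∧ (e = -1 ∨ e = 0 ∨ e = 1) := by
    intro i
    rcases hε i with h | h | h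
    · exact ⟨-1, by simp [h], by simp⟩
    · exact ⟨0, by simp [h], by simp⟩
    · exact ⟨1, by simp [h], by simp⟩
  choose e he he' using hlift
  refine absurd hlt (not_lt.2 ?_)
  have h := one_le_norm_sum_scaledWord c hc' (fun p => e (finSigmaFinEquiv p))
    (fun p => he' _) ?_
  · rw [← Equiv.sum_comp finSigmaFinEquiv]
    simp only [he] at h
    simpa only [Equiv.symm_apply_apply] using h
  · intro h
    refine hne (funext fun i => ?_)
    have := congrFun h (finSigmaFinEquiv.symm i)
    rw [← he]
    simpa using this

theorem sub_one_mul_le_sum {n L J : ℕ} (hJ : 4 ^ J * L ≤ n) :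
    ((J : ℝ) - 1) * n ≤ ((∑ j : Fin J, (n - 4 ^ (j : ℕ) * L) : ℕ) : ℝ) := by
  have hgeom : ∑ j ∈ Finset.range J, 4 ^ j ≤ 4 ^ J :=
    (Nat.geomSum_lt (m := 4) (n := J) (s := Finset.range J) (by norm_num) (by simp)).le
  have h : J * n ≤ (∑ j : Fin J, (n - 4 ^ (j : ℕ) * L)) + n := by
    rw [Fin.sum_univ_eq_sum_range (fun j => n - 4 ^ j * L)]
    calc J * n = ∑ j ∈ Finset.range J, n := by simp
      _ ≤ ∑ j ∈ Finset.range J, ((n - 4 ^ j * L) + 4 ^ j * L) :=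
        Finset.sum_le_sum fun j _ => le_tsub_add
      _ = (∑ j ∈ Finset.range J, (n - 4 ^ j * L)) + (∑ j ∈ Finset.range J, 4 ^ j) * L := by
        rw [Finset.sum_add_distrib, Finset.sum_mul]
      _ ≤ _ := by
        gcongr
        exact (Nat.mul_le_mul_right _ hgeom).trans hJ
  have h' : (J : ℝ) * n ≤ ((∑ j : Fin J, (n - 4 ^ (j : ℕ) * L) : ℕ) : ℝ) + n := by
    exact_mod_cast h
  linarith

open Filter in
theorem eventually_logb_add_one_le {δ : ℝ} (hδ : 0 < δ) :
    ∀ᶠ t : ℝ in atTop, Real.logb 2 (t + 1) / 2 + 2 ≤ δ * t := by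
  have hlog2 : 0 < Real.log 2 := Real.log_pos (by norm_num)
  have h := (Real.isLittleO_log_id_atTop.bound
    (c := δ * Real.log 2) (by positivity))
  have h' := (tendsto_atTop_add_const_right atTop (1 : ℝ) tendsto_id).eventually h
  filter_upwards [h', eventually_ge_atTop (0 : ℝ), eventually_ge_atTop ((δ / 2 + 2) / (δ / 2))]
    with t ht ht0 ht1
  simp only [id_eq, Real.norm_eq_abs] at ht
  rw [abs_of_nonneg (by linarith : 0 ≤ t + 1)] at ht
  have h1 : Real.logb 2 (t + 1) ≤ δ * (t + 1) := by
    rw [Real.logb, div_le_iff₀ hlog2]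
    linarith [le_abs_self (Real.log (t + 1))]
  rw [div_le_iff₀ (by positivity)] at ht1
  linarith

/-- for `c₂ < 1/2` and large `n`, there exist at least
`c₂ n log₂ n` unit vectors in `ℝ^n` that are not selectively balancing. -/
theorem selBal_lower (c₂ : ℝ) (hc₂ : c₂ < 1 / 2) :
    ∃ N : ℕ, ∀ n ≥ N, ∃ m : ℕ, c₂ * n * Real.logb 2 n ≤ m ∧
      ∃ u : Fin m → EuclideanSpace ℝ (Fin n),
        Function.Injective u ∧ (∀ i, ‖u i‖ = 1) ∧ ¬ SelectivelyBalancing u := by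
  have htend : Filter.Tendsto (fun n : ℕ => Real.logb 2 n) Filter.atTop Filter.atTop :=
    (Real.tendsto_logb_atTop (by norm_num)).comp tendsto_natCast_atTop_atTop
  obtain ⟨N, hN⟩ := Filter.eventually_atTop.1
    (htend.eventually (eventually_logb_add_one_le (sub_pos.2 hc₂)))
  refine ⟨max N 2, fun n hn => ?_⟩
  have hn2 : 2 ≤ n := (le_max_right _ _).trans hn
  have ht := hN n ((le_max_left _ _).trans hn)
  set L := Nat.log 2 n + 1
  set J := Nat.log 4 (n / L)
  have hnL : n < 2 ^ L := Nat.lt_pow_succ_log_self (by norm_num) n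
  have hLn : L ≤ n := Nat.log_lt_self 2 (by omega)
  have hL0 : 0 < L := Nat.succ_pos _
  have hJ : 4 ^ J * L ≤ n := (Nat.le_div_iff_mul_le hL0).1
    (Nat.pow_log_le_self 4 (Nat.div_pos hLn hL0).ne')
  have hJ' : n < 4 ^ (J + 1) * L := (Nat.div_lt_iff_lt_mul hL0).1
    (Nat.lt_pow_succ_log_self (by norm_num) (n / L))
  obtain ⟨u, hu, hub⟩ := exists_not_selectivelyBalancing_s9 hn2 hnL.le J
  refine ⟨_, ?_, u, injective_of_not_selectivelyBalancing hub, hu, hub⟩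
  refine le_trans ?_ (sub_one_mul_le_sum hJ)
  have hn0 : (0 : ℝ) < n := by positivity
  have hL0' : (0 : ℝ) < L := by exact_mod_cast hL0
  have hlogL : Real.logb 2 L ≤ Real.logb 2 (Real.logb 2 n + 1) := by
    refine Real.logb_le_logb_of_le (by norm_num) hL0' ?_
    have := Real.natLog_le_logb n 2
    push_cast [L]
    simpa using this
  have hlogn : Real.logb 2 n ≤ 2 * (J + 1) + Real.logb 2 L := by
    have h4 : Real.logb 2 ((4 : ℝ) ^ (J + 1)) = 2 * (J + 1) := by
      rw [show (4 : ℝ) = 2 ^ 2 by norm_num, ← pow_mul, Real.logb_pow]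
      simp
    rw [← h4, ← Real.logb_mul (by positivity) hL0'.ne']
    exact Real.logb_le_logb_of_le (by norm_num) hn0 (by exact_mod_cast hJ'.le)
  have hfin : c₂ * Real.logb 2 n ≤ (J : ℝ) - 1 := by linarith
  calc c₂ * n * Real.logb 2 n = c₂ * Real.logb 2 n * n := by ring
    _ ≤ _ := mul_le_mul_of_nonneg_right hfin hn0.le
end
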